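/- In the (n+k)-round evolution graph of any dynamic network whose communication graph is connected in every round, with k ≤ n token sources at level 0 (each source having a unit-capacity edge from an auxiliary vertex v₋₁) and an arbitrary fixed node v at level n+k, every cut separating v₋₁ from v_{n+k} has capacity at least k. Consequently, by max-flow min-cut, all k tokens can be gathered at v in at most n+k rounds. -/

import Mathlib

open Classical in
/-- Edge capacities of the evolution graph over `ℓ` rounds, augmented with the
auxiliary vertex `v₋₁` (encoded as `none`).  A vertex `some (j, u)` is the copy of
node `u` at level `j`.  `v₋₁` has an edge into each level-0 source with capacity
equal to the number of tokens whose source is that node (unit-capacity edges,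
fused); buffer edges `(u_j, u_{j+1})` have infinite capacity; transmit edges
`(u_j, w_{j+1})` for `(G j).Adj u w` have unit capacity. -/
noncomputable def evoCap (n k ℓ : ℕ) (G : ℕ → SimpleGraph (Fin n)) (src : Fin k → Fin n) :
    Option (ℕ × Fin n) → Option (ℕ × Fin n) → ENNReal := fun a b =>
  match a, b with
  | none, some (j, u) =>
      if j = 0 then ((Finset.univ.filter fun i => src i = u).card : ENNReal) else 0
  | some (j, u), some (j', w) =>
      if j' = j + 1 ∧ j < ℓ then
        (if u = w then ⊤ else if (G j).Adj u w then 1 else 0)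
      else 0
  | _, _ => 0

open Classical in
/-- Token holdings under a schedule `send` (one token per directed edge per round),
starting from the distribution where node `u` holds exactly the tokens `i` with
`src i = u`. -/
noncomputable def gatherRun (n k : ℕ) (G : ℕ → SimpleGraph (Fin n)) (src : Fin k → Fin n)
    (send : ℕ → Fin n → Fin n → Option (Fin k)) : ℕ → Fin n → Finset (Fin k)
  | 0 => fun u => Finset.univ.filter fun i => src i = u
  | r + 1 => fun v =>
      gatherRun n k G src send r v ∪
        Finset.univ.filter fun t =>
          ∃ u, (G r).Adj u v ∧ send r u v = some t ∧ t ∈ gatherRun n k G src send r u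

theorem SimpleGraph.Connected.exists_adj_mem_notMem {V : Type*} {H : SimpleGraph V}
    (hH : H.Connected) {A : Set V} {a b : V} (ha : a ∈ A) (hb : b ∉ A) :
    ∃ u w, H.Adj u w ∧ u ∈ A ∧ w ∉ A := by
  obtain ⟨p⟩ := hH.preconnected a b
  obtain ⟨d, -, h₁, h₂⟩ := p.exists_boundary_dart A ha hb
  exact ⟨d.fst, d.snd, d.adj, h₁, h₂⟩

open Classical in
/-- The transmit edges of the first `ℓ` rounds that leave the level sets `S`. -/
noncomputable def crossingEdges {n : ℕ} (G : ℕ → SimpleGraph (Fin n)) (S : ℕ → Finset (Fin n))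
    (ℓ : ℕ) : Finset (ℕ × Fin n × Fin n) :=
  (Finset.range ℓ ×ˢ Finset.univ).filter fun e =>
    (G e.1).Adj e.2.1 e.2.2 ∧ e.2.1 ∈ S e.1 ∧ e.2.2 ∉ S (e.1 + 1)

theorem mem_crossingEdges {n ℓ : ℕ} {G : ℕ → SimpleGraph (Fin n)} {S : ℕ → Finset (Fin n)}
    {j : ℕ} {u w : Fin n} :
    (j, u, w) ∈ crossingEdges G S ℓ ↔ j < ℓ ∧ (G j).Adj u w ∧ u ∈ S j ∧ w ∉ S (j + 1) := by
  simp [crossingEdges]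

theorem card_add_le_card_add_card_crossingEdges {n : ℕ} {G : ℕ → SimpleGraph (Fin n)}
    (hconn : ∀ r, (G r).Connected) {S : ℕ → Finset (Fin n)} (h₀ : (S 0).Nonempty) {v : Fin n}
    (ℓ : ℕ) (hS : ∀ j < ℓ, S j ⊆ S (j + 1)) (hv : v ∉ S ℓ) :
    (S 0).card + ℓ ≤ (S ℓ).card + (crossingEdges G S ℓ).card := by
  induction ℓ with
  | zero => omega
  | succ ℓ ih =>
    have hsub : S ℓ ⊆ S (ℓ + 1) := hS ℓ (by omega)
    have ih := ih (fun j hj => hS j (by omega)) fun h => hv (hsub h)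
    have hmono : crossingEdges G S ℓ ⊆ crossingEdges G S (ℓ + 1) := by
      rintro ⟨j, u, w⟩
      simp only [mem_crossingEdges]
      rintro ⟨hj, h⟩
      exact ⟨by omega, h⟩
    by_cases heq : S ℓ = S (ℓ + 1)
    · have hne : (S ℓ).Nonempty := by
        by_contra hne
        have hle : ∀ m ≤ ℓ, S 0 ⊆ S m := by
          intro m
          induction m with
          | zero => intro _; exact subset_rfl
          | succ m ihm => intro hm; exact (ihm (by omega)).trans (hS m (by omega))
        exact hne (h₀.mono (hle ℓ le_rfl))
      obtain ⟨a, ha⟩ := hne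
      obtain ⟨u, w, hadj, hu, hw⟩ := (hconn ℓ).exists_adj_mem_notMem
        (A := (S ℓ : Set (Fin n))) (a := a) (b := v) (by simpa using ha)
        (by simpa [heq] using hv)
      have hlt : (crossingEdges G S ℓ).card < (crossingEdges G S (ℓ + 1)).card := by
        refine Finset.card_lt_card ((Finset.ssubset_iff_of_subset hmono).2 ⟨(ℓ, u, w), ?_, ?_⟩)
        · rw [mem_crossingEdges]
          exact ⟨by omega, hadj, by simpa using hu, by simpa [← heq] using hw⟩
        · simp [mem_crossingEdges]
      rw [← heq]
      omega
    · have := Finset.card_lt_card (hsub.ssubset_of_ne heq)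
      have := Finset.card_le_card hmono
      omega

theorem le_card_crossingEdges {n k : ℕ} {G : ℕ → SimpleGraph (Fin n)}
    (hconn : ∀ r, (G r).Connected) {S : ℕ → Finset (Fin n)} (h₀ : (S 0).Nonempty) {v : Fin n}
    (hS : ∀ j < n + k, S j ⊆ S (j + 1)) (hv : v ∉ S (n + k)) :
    k ≤ (crossingEdges G S (n + k)).card := by
  have := card_add_le_card_add_card_crossingEdges hconn h₀ (n + k) hS hv
  have := Finset.card_le_univ (S (n + k))
  simp only [Fintype.card_fin] at this
  omega

theorem ENNReal.sum_le_tsum_cut {α ι : Type*} (f : α → α → ENNReal) (S : Set α) (s : Finset ι)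
    (g : ι → α × α) (hg : Set.InjOn g s) (hmem : ∀ i ∈ s, (g i).1 ∈ S ∧ (g i).2 ∉ S) :
    ∑ i ∈ s, f (g i).1 (g i).2 ≤ ∑' (a : S) (b : ↥Sᶜ), f a b := by
  rw [← ENNReal.tsum_prod (f := fun (a : S) (b : ↥Sᶜ) => f a b), ← Finset.sum_attach]
  let e : s → S × ↥Sᶜ := fun i => (⟨_, (hmem i i.2).1⟩, ⟨_, (hmem i i.2).2⟩)
  have he : Function.Injective e := by
    intro i j hij
    simp only [e, Prod.mk.injEq, Subtype.mk.injEq] at hij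
    exact Subtype.ext (hg i.2 j.2 (Prod.ext hij.1 hij.2))
  calc ∑ i ∈ s.attach, f (g i).1 (g i).2 = ∑ i ∈ s.attach, f (e i).1 (e i).2 := rfl
    _ ≤ ∑' i, f (e i).1 (e i).2 := ENNReal.sum_le_tsum _
    _ ≤ _ := ENNReal.tsum_comp_le_tsum_of_injective he fun p : S × ↥Sᶜ => f p.1 p.2

theorem le_tsum_evoCap {n k : ℕ} {G : ℕ → SimpleGraph (Fin n)} (hconn : ∀ r, (G r).Connected)
    (src : Fin k → Fin n) {v : Fin n} {S : Set (Option (ℕ × Fin n))} (hnone : none ∈ S)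
    (hv : some (n + k, v) ∉ S) :
    (k : ENNReal) ≤ ∑' (a : S) (b : ↥Sᶜ), evoCap n k (n + k) G src ↑a ↑b := by
  classical
  by_cases hbuf : ∃ j u, j < n + k ∧ some (j, u) ∈ S ∧ some (j + 1, u) ∉ S
  · obtain ⟨j, u, hj, h₁, h₂⟩ := hbuf
    have h := ENNReal.sum_le_tsum_cut (evoCap n k (n + k) G src) S {()}
      (fun _ => (some (j, u), some (j + 1, u))) (by simp) (by simp [h₁, h₂])
    simp only [Finset.sum_singleton] at h
    refine le_trans ?_ h
    simp [evoCap, hj]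
  push Not at hbuf
  let L : ℕ → Finset (Fin n) := fun j => Finset.univ.filter fun u => some (j, u) ∈ S
  by_cases h₀ : (L 0).Nonempty
  · have hk := le_card_crossingEdges (k := k) hconn h₀ (v := v)
      (fun j hj u hu => by simp only [L, Finset.mem_filter_univ] at hu ⊢; exact hbuf j u hj hu)
      (by simpa [L] using hv)
    have h := ENNReal.sum_le_tsum_cut (evoCap n k (n + k) G src) S (crossingEdges G L (n + k))
      (fun e => (some (e.1, e.2.1), some (e.1 + 1, e.2.2)))
      (by rintro ⟨j, u, w⟩ - ⟨j', u', w'⟩ - h; simp at h ⊢; tauto)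
      (by
        rintro ⟨j, u, w⟩ he
        rw [mem_crossingEdges] at he
        simpa [L] using he.2.2)
    refine le_trans ?_ h
    rw [Finset.sum_congr rfl (g := fun _ => 1)]
    · simpa using hk
    · rintro ⟨j, u, w⟩ he
      rw [mem_crossingEdges] at he
      simp [evoCap, he.1, he.2.1, he.2.1.ne]
  · have h₀ : ∀ u, some (0, u) ∉ S := by
      intro u hu
      exact h₀ ⟨u, by simpa [L] using hu⟩
    have h := ENNReal.sum_le_tsum_cut (evoCap n k (n + k) G src) S (Finset.univ (α := Fin n))
      (fun u => (none, some (0, u))) (by intro u _ w _ h; simpa using h) (by simp [hnone, h₀])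
    refine le_trans (le_of_eq ?_) h
    have hcard := Finset.card_eq_sum_card_fiberwise (f := src) (s := Finset.univ)
      (t := Finset.univ) (by simp)
    simp only [Finset.card_univ, Fintype.card_fin] at hcard
    simp only [evoCap, if_true]
    exact_mod_cast hcard

/-- An item is either a token `i`, or a transmit edge `(j, u, w)`; this is the node at which a
unit of flow through it comes out. -/
def itemNode {n k : ℕ} (src : Fin k → Fin n) : Fin k ⊕ (ℕ × Fin n × Fin n) → Fin n
  | .inl i => src i
  | .inr e => e.2.2

/-- The level at which a unit of flow through an item comes out. -/
def itemLevel {n k : ℕ} : Fin k ⊕ (ℕ × Fin n × Fin n) → ℕ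
  | .inl _ => 0
  | .inr e => e.1 + 1

/-- The transmit edge `e` can follow the item `x` on a path, after some buffer edges. -/
def Follows {n k : ℕ} (G : ℕ → SimpleGraph (Fin n)) (src : Fin k → Fin n)
    (x : Fin k ⊕ (ℕ × Fin n × Fin n)) (e : ℕ × Fin n × Fin n) : Prop :=
  e.1 < n + k ∧ (G e.1).Adj e.2.1 e.2.2 ∧ e.2.1 = itemNode src x ∧ itemLevel x ≤ e.1

/-- Hall's theorem gives an integral flow: every item not ending at `v` is matched to a following
transmit edge, or to itself if it is unused. -/
theorem exists_successor {n k : ℕ} {G : ℕ → SimpleGraph (Fin n)} (hconn : ∀ r, (G r).Connected)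
    (src : Fin k → Fin n) (v : Fin n) :
    ∃ φ : Fin k ⊕ (ℕ × Fin n × Fin n) → ℕ × Fin n × Fin n,
      Set.InjOn φ {x | itemNode src x ≠ v} ∧
      ∀ x, itemNode src x ≠ v → x = .inr (φ x) ∨ Follows G src x (φ x) := by
  classical
  let t : {x // itemNode src x ≠ v} → Finset (ℕ × Fin n × Fin n) := fun x =>
    ({x.1} : Finset (Fin k ⊕ (ℕ × Fin n × Fin n))).toRight ∪ (Finset.range (n + k) ×ˢ Finset.univ).filter (Follows G src x.1)
  have ht : ∀ x e, e ∈ t x ↔ x.1 = .inr e ∨ Follows G src x.1 e := by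
    rintro x ⟨j, u, w⟩
    simp only [t, Follows, Finset.mem_union, Finset.mem_toRight, Finset.mem_singleton,
      Finset.mem_filter, Finset.mem_product, Finset.mem_range, Finset.mem_univ]
    grind
  have hall : ∀ W : Finset {x // itemNode src x ≠ v}, W.card ≤ (W.biUnion t).card := by
    intro W
    let X := W.map (Function.Embedding.subtype _)
    have hX : ∀ x, x ∈ X → itemNode src x ≠ v := by
      intro x hx
      simp only [X, Finset.mem_map] at hx
      obtain ⟨y, -, rfl⟩ := hx
      exact y.2
    have hcover : ∀ x e, x ∈ X → x = .inr e ∨ Follows G src x e → e ∈ W.biUnion t := by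
      intro x e hx h
      simp only [X, Finset.mem_map] at hx
      obtain ⟨y, hy, rfl⟩ := hx
      exact Finset.mem_biUnion.2 ⟨y, hy, (ht y e).2 h⟩
    have hcard : W.card = X.toLeft.card + X.toRight.card := by
      rw [Finset.card_toLeft_add_card_toRight, Finset.card_map]
    have hright : X.toRight ⊆ W.biUnion t := fun e he =>
      hcover (.inr e) e (Finset.mem_toRight.1 he) (.inl rfl)
    rcases X.toLeft.eq_empty_or_nonempty with hleft | ⟨i, hi⟩
    · rw [hcard, hleft, Finset.card_empty, zero_add]
      exact Finset.card_le_card hright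
    let S : ℕ → Finset (Fin n) := fun j =>
      Finset.univ.filter fun u => ∃ x ∈ X, itemNode src x = u ∧ itemLevel x ≤ j
    have hS : ∀ j u, u ∈ S j ↔ ∃ x ∈ X, itemNode src x = u ∧ itemLevel x ≤ j := by simp [S]
    have hk : k ≤ (crossingEdges G S (n + k)).card := by
      refine le_card_crossingEdges hconn (v := v) ⟨src i, ?_⟩ ?_ ?_
      · exact (hS _ _).2 ⟨.inl i, Finset.mem_toLeft.1 hi, rfl, le_rfl⟩
      · intro j _ u hu
        obtain ⟨x, hx, hxu, hxj⟩ := (hS _ _).1 hu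
        exact (hS _ _).2 ⟨x, hx, hxu, by omega⟩
      · intro hv
        obtain ⟨x, hx, hxv, -⟩ := (hS _ _).1 hv
        exact hX x hx hxv
    have hcross : crossingEdges G S (n + k) ⊆ W.biUnion t := by
      rintro ⟨j, u, w⟩ he
      obtain ⟨hj, hadj, hu, -⟩ := mem_crossingEdges.1 he
      obtain ⟨x, hx, hxu, hxj⟩ := (hS _ _).1 hu
      exact hcover x _ hx (.inr ⟨hj, hadj, hxu.symm, hxj⟩)
    have hdisj : Disjoint (crossingEdges G S (n + k)) X.toRight := by
      rw [Finset.disjoint_left]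
      rintro ⟨j, u, w⟩ he he'
      exact (mem_crossingEdges.1 he).2.2.2
        ((hS _ _).2 ⟨_, Finset.mem_toRight.1 he', rfl, le_rfl⟩)
    have hleft : X.toLeft.card ≤ k := by simpa using Finset.card_le_univ X.toLeft
    calc W.card ≤ (crossingEdges G S (n + k)).card + X.toRight.card := by omega
      _ = (crossingEdges G S (n + k) ∪ X.toRight).card := (Finset.card_union_of_disjoint hdisj).symm
      _ ≤ (W.biUnion t).card := Finset.card_le_card (Finset.union_subset hcross hright)
  obtain ⟨f, hf, hft⟩ := (Finset.all_card_le_biUnion_card_iff_exists_injective t).1 hall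
  refine ⟨fun x => if h : itemNode src x ≠ v then f ⟨x, h⟩ else (0, v, v), ?_, ?_⟩
  · intro x hx y hy hxy
    simp only [Set.mem_ofPred_eq] at hx hy
    simp only [dif_pos hx, dif_pos hy] at hxy
    exact congrArg Subtype.val (hf hxy)
  · intro x hx
    simp only [dif_pos hx]
    exact (ht _ _).1 (hft ⟨x, hx⟩)

/-- The items on the path of token `i` obtained by following successors until `v` is reached. -/
inductive OnPath {n k : ℕ} (src : Fin k → Fin n) (v : Fin n)
    (φ : Fin k ⊕ (ℕ × Fin n × Fin n) → ℕ × Fin n × Fin n) (i : Fin k) :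
    Fin k ⊕ (ℕ × Fin n × Fin n) → Prop
  | start : OnPath src v φ i (.inl i)
  | next {x} : OnPath src v φ i x → itemNode src x ≠ v → OnPath src v φ i (.inr (φ x))

section OnPath

variable {n k : ℕ} {G : ℕ → SimpleGraph (Fin n)} {src : Fin k → Fin n} {v : Fin n}
  {φ : Fin k ⊕ (ℕ × Fin n × Fin n) → ℕ × Fin n × Fin n}

theorem OnPath.unique (hinj : Set.InjOn φ {x | itemNode src x ≠ v}) {i i' : Fin k}
    {x : Fin k ⊕ (ℕ × Fin n × Fin n)} (h : OnPath src v φ i x) (h' : OnPath src v φ i' x) :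
    i = i' := by
  induction h with
  | start => cases h'; rfl
  | @next x _ hx ih =>
    generalize hz : (Sum.inr (φ x) : Fin k ⊕ (ℕ × Fin n × Fin n)) = z at h'
    cases h' with
    | start => cases hz
    | @next y hy hyv =>
      have := hinj hx hyv (Sum.inr_injective hz)
      subst this
      exact ih hy

theorem OnPath.ne_successor (hinj : Set.InjOn φ {x | itemNode src x ≠ v}) {i : Fin k}
    {x : Fin k ⊕ (ℕ × Fin n × Fin n)} (h : OnPath src v φ i x) (hxv : itemNode src x ≠ v) :
    x ≠ .inr (φ x) := by
  induction h with
  | start => exact Sum.inl_ne_inr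
  | @next x _ hx ih =>
    intro heq
    have := hinj hx hxv (Sum.inr_injective heq)
    exact ih hx this

theorem OnPath.follows (hinj : Set.InjOn φ {x | itemNode src x ≠ v})
    (hφ : ∀ x, itemNode src x ≠ v → x = .inr (φ x) ∨ Follows G src x (φ x)) {i : Fin k}
    {x : Fin k ⊕ (ℕ × Fin n × Fin n)} (h : OnPath src v φ i x) (hxv : itemNode src x ≠ v) :
    Follows G src x (φ x) :=
  (hφ x hxv).resolve_left (h.ne_successor hinj hxv)

theorem OnPath.exists_itemNode_eq (hinj : Set.InjOn φ {x | itemNode src x ≠ v})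
    (hφ : ∀ x, itemNode src x ≠ v → x = .inr (φ x) ∨ Follows G src x (φ x)) {i : Fin k}
    {x : Fin k ⊕ (ℕ × Fin n × Fin n)} (h : OnPath src v φ i x) (hx : itemLevel x ≤ n + k) :
    ∃ y, OnPath src v φ i y ∧ itemNode src y = v ∧ itemLevel y ≤ n + k := by
  by_cases hxv : itemNode src x = v
  · exact ⟨x, h, hxv, hx⟩
  · have hf := h.follows hinj hφ hxv
    have hlt : itemLevel x ≤ (φ x).1 := hf.2.2.2
    have hle : (φ x).1 < n + k := hf.1
    exact (h.next hxv).exists_itemNode_eq hinj hφ (by simp only [itemLevel]; omega)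
termination_by n + k - itemLevel x
decreasing_by
  change n + k - ((φ x).1 + 1) < n + k - itemLevel x
  omega

end OnPath

theorem gatherRun_mono {n k : ℕ} (G : ℕ → SimpleGraph (Fin n)) (src : Fin k → Fin n)
    (send : ℕ → Fin n → Fin n → Option (Fin k)) (u : Fin n) :
    Monotone fun r => gatherRun n k G src send r u :=
  monotone_nat_of_le_succ fun r => by
    simp only [gatherRun]
    exact Finset.subset_union_left

theorem exists_gathering_schedule {n k : ℕ} {G : ℕ → SimpleGraph (Fin n)}
    (hconn : ∀ r, (G r).Connected) (src : Fin k → Fin n) (v : Fin n) :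
    ∃ send : ℕ → Fin n → Fin n → Option (Fin k),
      (∀ r u w t, send r u w = some t →
        (G r).Adj u w ∧ t ∈ gatherRun n k G src send r u) ∧
      ∀ i : Fin k, i ∈ gatherRun n k G src send (n + k) v := by
  classical
  obtain ⟨φ, hinj, hφ⟩ := exists_successor hconn src v
  let send : ℕ → Fin n → Fin n → Option (Fin k) := fun r u w =>
    if h : ∃ i, OnPath src v φ i (.inr (r, u, w)) then some h.choose else none
  have hsend : ∀ r u w i, send r u w = some i ↔ OnPath src v φ i (.inr (r, u, w)) := by
    intro r u w i
    by_cases h : ∃ i, OnPath src v φ i (.inr (r, u, w))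
    · simp only [send, dif_pos h, Option.some.injEq]
      exact ⟨fun hi => hi ▸ h.choose_spec, fun hi => h.choose_spec.unique hinj hi⟩
    · simp only [send, dif_neg h, reduceCtorEq, false_iff]
      exact fun hi => h ⟨i, hi⟩
  have hdepart : ∀ {i x}, OnPath src v φ i x → itemNode src x ≠ v →
      i ∈ gatherRun n k G src send (itemLevel x) (itemNode src x) →
      (G (φ x).1).Adj (φ x).2.1 (φ x).2.2 ∧ i ∈ gatherRun n k G src send (φ x).1 (φ x).2.1 := by
    intro i x hx hxv hi
    obtain ⟨-, hadj, hnode, hlevel⟩ := hx.follows hinj hφ hxv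
    refine ⟨hadj, ?_⟩
    rw [hnode]
    exact gatherRun_mono G src send _ hlevel hi
  have hold : ∀ {i x}, OnPath src v φ i x →
      i ∈ gatherRun n k G src send (itemLevel x) (itemNode src x) := by
    intro i x hx
    induction hx with
    | start => simp [gatherRun, itemLevel, itemNode]
    | @next x hx hxv ih =>
      obtain ⟨hadj, hi⟩ := hdepart hx hxv ih
      simp only [gatherRun, itemLevel, itemNode, Finset.mem_union, Finset.mem_filter_univ]
      exact .inr ⟨_, hadj, (hsend _ _ _ _).2 (hx.next hxv), hi⟩
  refine ⟨send, ?_, ?_⟩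
  · intro r u w i h
    have h := (hsend r u w i).1 h
    generalize hz : (Sum.inr (r, u, w) : Fin k ⊕ (ℕ × Fin n × Fin n)) = z at h
    cases h with
    | start => cases hz
    | @next x hx hxv =>
      have hd := hdepart hx hxv (hold hx)
      rw [← Sum.inr_injective hz] at hd
      exact hd
  · intro i
    obtain ⟨y, hy, hyv, hle⟩ :=
      (OnPath.start (src := src) (v := v) (φ := φ) (i := i)).exists_itemNode_eq hinj hφ
        (Nat.zero_le _)
    exact gatherRun_mono G src send v hle (hyv ▸ hold hy)

/-- In the `(n+k)`-round evolution graph of a dynamic network that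
is connected in every round, with `k ≤ n` token sources at level 0 fed by
unit-capacity edges from the auxiliary vertex `v₋₁`, every cut separating `v₋₁`
from the copy of an arbitrary node `v` at level `n+k` has capacity at least `k`;
consequently (by max-flow min-cut) all `k` tokens can be gathered at `v` in at most
`n+k` rounds. -/
theorem stmt_12 (n k : ℕ) (hn : 0 < n) (hk : k ≤ n)
    (G : ℕ → SimpleGraph (Fin n)) (hconn : ∀ r, (G r).Connected)
    (src : Fin k → Fin n) (v : Fin n) :
    (∀ S : Set (Option (ℕ × Fin n)), none ∈ S → some (n + k, v) ∉ S →
      (k : ENNReal) ≤ ∑' (a : S) (b : ↥Sᶜ), evoCap n k (n + k) G src ↑a ↑b) ∧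
    ∃ send : ℕ → Fin n → Fin n → Option (Fin k),
      (∀ r u w t, send r u w = some t →
        (G r).Adj u w ∧ t ∈ gatherRun n k G src send r u) ∧
      ∀ i : Fin k, i ∈ gatherRun n k G src send (n + k) v := by
  exact ⟨fun _ hnone hv => le_tsum_evoCap hconn src hnone hv,
    exists_gathering_schedule hconn src v⟩
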